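/- There is an absolute constant C > 0 with the following property. Let F be a finite field with q elements, let a ∈ F^×, let ℓ ≥ 0 be an integer, and let 1 ≤ k ≤ n. Then the number of squarefree monic polynomials f of degree n over F with constant coefficient a having exactly ℓ distinct monic irreducible factors of degree ≤ k is at most C·(q^{n−1}/k)·(H_k^ℓ/ℓ!)·(1 + ℓ/H_k). -/

import Mathlib

open Polynomial

/-- The harmonic sum `H_k = 1 + 1/2 + ⋯ + 1/k`. -/
noncomputable def harm (k : ℕ) : ℝ := ∑ i ∈ Finset.Icc 1 k, (1 : ℝ) / i

theorem degree_mul_card_le_of_dvd {F : Type*} [Field F] {d : ℕ} {Q : F[X]} (hQ : Q ≠ 0)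
    (s : Finset F[X]) (hs : ∀ p ∈ s, p.Monic ∧ Irreducible p ∧ p.natDegree = d ∧ p ∣ Q) :
    d * s.card ≤ Q.natDegree := by
  have hdvd : ∏ p ∈ s, p ∣ Q := by
    refine Finset.prod_dvd_of_isRelPrime ?_ fun p hp ↦ (hs p hp).2.2.2
    intro p hp r hr hpr
    refine (hs p hp).2.1.isRelPrime_iff_not_dvd.2 fun h ↦ hpr ?_
    exact eq_of_monic_of_associated (hs p hp).1 (hs r hr).1
      ((hs p hp).2.1.associated_of_dvd (hs r hr).2.1 h)
  have hdeg := natDegree_le_of_dvd hdvd hQ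
  rw [natDegree_prod _ _ fun p hp ↦ (hs p hp).1.ne_zero,
    Finset.sum_congr rfl fun p hp ↦ (hs p hp).2.2.1] at hdeg
  simpa [mul_comm] using hdeg

theorem irreducible_dvd_X_pow_card_pow_sub_X {F : Type*} [Field F] [Fintype F] {p : F[X]}
    (hp : p.Monic) (hirr : Irreducible p) :
    p ∣ X ^ Fintype.card F ^ p.natDegree - X := by
  have : Fact (Irreducible p) := ⟨hirr⟩
  let pb := AdjoinRoot.powerBasis hp.ne_zero
  have : Module.Finite F (AdjoinRoot p) := pb.finite
  have : Finite (AdjoinRoot p) := Module.finite_of_finite F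
  have : Fintype (AdjoinRoot p) := Fintype.ofFinite _
  have hcard : Fintype.card (AdjoinRoot p) = Fintype.card F ^ p.natDegree := by
    rw [Module.card_eq_pow_finrank (K := F), pb.finrank, AdjoinRoot.powerBasis_dim]
  rw [← AdjoinRoot.mk_eq_zero, map_sub, map_pow, AdjoinRoot.mk_X, ← hcard,
    FiniteField.pow_card, sub_self]

theorem irreducible_dvd_X_pow_sub_C_coeff_zero {F : Type*} [Field F] [Fintype F] {p : F[X]}
    (hp : p.Monic) (hirr : Irreducible p) :
    p ∣ X ^ (∑ i ∈ Finset.range p.natDegree, Fintype.card F ^ i) -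
      C ((-1) ^ p.natDegree * p.coeff 0) := by
  have : Fact (Irreducible p) := ⟨hirr⟩
  let pb := AdjoinRoot.powerBasis hp.ne_zero
  have : Module.Finite F (AdjoinRoot p) := pb.finite
  have : Finite (AdjoinRoot p) := Module.finite_of_finite F
  have hrank : Module.finrank F (AdjoinRoot p) = p.natDegree := by
    rw [pb.finrank, AdjoinRoot.powerBasis_dim]
  have hnorm := Algebra.PowerBasis.norm_gen_eq_coeff_zero_minpoly pb
  rw [AdjoinRoot.minpoly_powerBasis_gen_of_monic hp, AdjoinRoot.powerBasis_gen,
    AdjoinRoot.powerBasis_dim] at hnorm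
  have hpow := FiniteField.algebraMap_norm_eq_pow_sum F (AdjoinRoot p) (AdjoinRoot.root p)
  rw [hnorm, hrank, Nat.card_eq_fintype_card] at hpow
  rw [← AdjoinRoot.mk_eq_zero, map_sub, map_pow, AdjoinRoot.mk_X, ← hpow, AdjoinRoot.mk_C,
    AdjoinRoot.algebraMap_eq, sub_self]

/-- There are at most `q ^ d / d` monic irreducible polynomials of degree `d`. -/
theorem degree_mul_card_irreducible_le {F : Type*} [Field F] [Fintype F] {d : ℕ} (hd : 1 ≤ d)
    (s : Finset F[X]) (hs : ∀ p ∈ s, p.Monic ∧ Irreducible p ∧ p.natDegree = d) :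
    d * s.card ≤ Fintype.card F ^ d := by
  have hlt : 1 < Fintype.card F ^ d := Nat.one_lt_pow (by lia) Fintype.one_lt_card
  have h := degree_mul_card_le_of_dvd (FiniteField.X_pow_card_sub_X_ne_zero F hlt) s
    fun p hp ↦ ⟨(hs p hp).1, (hs p hp).2.1, (hs p hp).2.2,
      (hs p hp).2.2 ▸ irreducible_dvd_X_pow_card_pow_sub_X (hs p hp).1 (hs p hp).2.1⟩
  rwa [FiniteField.X_pow_card_sub_X_natDegree_eq F hlt] at h

/-- There are at most `2 q ^ (d - 1) / d` monic irreducible polynomials of degree `d` with a given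
constant coefficient. -/
theorem degree_mul_card_irreducible_coeff_zero_le {F : Type*} [Field F] [Fintype F] {d : ℕ}
    (hd : 1 ≤ d) (b : F) (s : Finset F[X])
    (hs : ∀ p ∈ s, p.Monic ∧ Irreducible p ∧ p.natDegree = d ∧ p.coeff 0 = b) :
    d * s.card ≤ 2 * Fintype.card F ^ (d - 1) := by
  obtain ⟨e, rfl⟩ : ∃ e, d = e + 1 := ⟨d - 1, by lia⟩
  have hq : 2 ≤ Fintype.card F := Fintype.one_lt_card
  have hpos : 0 < ∑ i ∈ Finset.range (e + 1), Fintype.card F ^ i := by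
    rw [Finset.sum_range_succ']; simp
  have h := degree_mul_card_le_of_dvd (X_pow_sub_C_ne_zero hpos ((-1) ^ (e + 1) * b)) s
    fun p hp ↦ ⟨(hs p hp).1, (hs p hp).2.1, (hs p hp).2.2.1, by
      have := irreducible_dvd_X_pow_sub_C_coeff_zero (hs p hp).1 (hs p hp).2.1
      rwa [(hs p hp).2.2.1, (hs p hp).2.2.2] at this⟩
  rw [natDegree_X_pow_sub_C, Finset.sum_range_succ] at h
  have := Nat.geomSum_lt (n := e) (s := Finset.range e) hq (by simp)
  simp only [Nat.add_sub_cancel]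
  lia

theorem pow_succ_add_le_add_pow {x y : ℝ} (hx : 0 ≤ x) (hy : 0 ≤ y) (j : ℕ) :
    x ^ (j + 1) + (j + 1) * (y * x ^ j) ≤ (x + y) ^ (j + 1) := by
  induction j with
  | zero => simp
  | succ j ih =>
    have h : (0 : ℝ) ≤ (j + 1) * (y * x ^ j) * y := by positivity
    calc x ^ (j + 1 + 1) + (↑(j + 1) + 1) * (y * x ^ (j + 1))
        ≤ (x ^ (j + 1) + (j + 1) * (y * x ^ j)) * (x + y) := by push_cast; linarith [h, show
          (x ^ (j + 1) + (j + 1) * (y * x ^ j)) * (x + y) = x ^ (j + 1 + 1) +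
            ((j + 1) + 1) * (y * x ^ (j + 1)) + (j + 1) * (y * x ^ j) * y by ring]
      _ ≤ (x + y) ^ (j + 1) * (x + y) := by gcongr
      _ = (x + y) ^ (j + 1 + 1) := (pow_succ _ _).symm

/-- Weighted count of the subsets of `P` with exactly `j` elements satisfying `D`. -/
theorem sum_powerset_prod_le {ι : Type*} [DecidableEq ι] (P : Finset ι) (D : ι → Prop)
    [DecidablePred D] {w : ι → ℝ} (hw : ∀ p, 0 ≤ w p) (j : ℕ) :
    ∑ T ∈ P.powerset, (if (T.filter D).card = j then ∏ p ∈ T, w p else 0) ≤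
      (∑ p ∈ P with D p, w p) ^ j / j.factorial * ∏ p ∈ P with ¬ D p, (1 + w p) := by
  induction P using Finset.induction_on generalizing j with
  | empty => rcases j with _ | j <;> simp
  | insert x P hx ih =>
    have hprod : ∀ T ∈ P.powerset, ∏ p ∈ insert x T, w p = w x * ∏ p ∈ T, w p := fun T hT ↦
      Finset.prod_insert fun h ↦ hx (Finset.mem_powerset.1 hT h)
    have hcard : ∀ T ∈ P.powerset, D x →
        ((insert x T).filter D).card = (T.filter D).card + 1 := fun T hT hD ↦ by
      rw [Finset.filter_insert, if_pos hD, Finset.card_insert_of_notMem]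
      exact fun h ↦ hx (Finset.mem_powerset.1 hT (Finset.mem_filter.1 h).1)
    have hpos : 0 ≤ ∏ p ∈ P with ¬ D p, (1 + w p) :=
      Finset.prod_nonneg fun p _ ↦ by linarith [hw p]
    have hsum : 0 ≤ ∑ p ∈ P with D p, w p := Finset.sum_nonneg fun p _ ↦ hw p
    rw [Finset.sum_powerset_insert hx]
    by_cases hD : D x
    · rw [Finset.filter_insert, if_pos hD, Finset.filter_insert, if_neg (not_not.2 hD),
        Finset.sum_insert (by simp [hx])]
      rcases j with _ | j
      · have h0 : ∑ T ∈ P.powerset, (if ((insert x T).filter D).card = 0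
            then ∏ p ∈ insert x T, w p else 0) = 0 :=
          Finset.sum_eq_zero fun T hT ↦ by rw [hcard T hT hD, if_neg (Nat.succ_ne_zero _)]
        rw [h0]
        simpa using ih 0
      · have hj : ∑ T ∈ P.powerset, (if ((insert x T).filter D).card = j + 1
            then ∏ p ∈ insert x T, w p else 0) =
            w x * ∑ T ∈ P.powerset, if (T.filter D).card = j then ∏ p ∈ T, w p else 0 := by
          rw [Finset.mul_sum]
          refine Finset.sum_congr rfl fun T hT ↦ ?_
          rw [hcard T hT hD, hprod T hT]
          simp
        rw [hj]
        refine (add_le_add (ih (j + 1)) (mul_le_mul_of_nonneg_left (ih j) (hw x))).trans ?_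
        rw [← mul_assoc, ← add_mul]
        refine mul_le_mul_of_nonneg_right ?_ hpos
        have := pow_succ_add_le_add_pow hsum (hw x) j
        rw [Nat.factorial_succ, add_comm (w x)]
        push_cast
        have hf : (0 : ℝ) < j.factorial := by positivity
        rw [le_div_iff₀ (by positivity)]
        refine le_of_eq_of_le ?_ this
        field_simp
    · rw [Finset.filter_insert, if_neg hD, Finset.filter_insert, if_pos hD,
        Finset.prod_insert (by simp [hx])]
      have hj : ∑ T ∈ P.powerset, (if ((insert x T).filter D).card = j
          then ∏ p ∈ insert x T, w p else 0) =
          w x * ∑ T ∈ P.powerset, if (T.filter D).card = j then ∏ p ∈ T, w p else 0 := by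
        rw [Finset.mul_sum]
        refine Finset.sum_congr rfl fun T hT ↦ ?_
        rw [Finset.filter_insert, if_neg hD, hprod T hT, mul_ite, mul_zero]
      rw [hj]
      have := mul_le_mul_of_nonneg_left (ih j) (add_nonneg zero_le_one (hw x))
      linarith

theorem exp_sum_inv_le {k n : ℕ} (hk : 1 ≤ k) (hkn : k ≤ n) :
    Real.exp (∑ d ∈ Finset.Ioc k n, (1 : ℝ) / d) ≤ n / k := by
  induction n, hkn using Nat.le_induction with
  | base =>
    have : (0 : ℝ) < k := by exact_mod_cast hk
    simp [this.ne']
  | succ n hn ih =>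
    have hk0 : (0 : ℝ) < k := by exact_mod_cast hk
    have hn0 : (0 : ℝ) < n := by exact_mod_cast hk.trans hn
    rw [← Finset.insert_Ioc_right_eq_Ioc_add_one hn, Finset.sum_insert (by simp), Real.exp_add]
    have h : Real.exp (1 / ((n + 1 : ℕ) : ℝ)) ≤ (n + 1) / n := by
      have h1 := Real.add_one_le_exp (-(1 / ((n + 1 : ℕ) : ℝ)))
      have h2 : -(1 / ((n + 1 : ℕ) : ℝ)) + 1 = n / (n + 1) := by push_cast; field_simp; ring
      rw [h2, Real.exp_neg] at h1
      have h3 := inv_anti₀ (by positivity) h1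
      rwa [inv_inv, inv_div] at h3
    calc _ ≤ ((n + 1 : ℝ) / n) * (n / k) := by gcongr
      _ = _ := by push_cast; field_simp

/-- Double counting of pairs `(S, p)` with `p ∈ S`, weighted by `deg p`. -/
theorem mul_card_le_sum_powerset {ι F : Type*} [DecidableEq ι] [Field F] [DecidableEq F]
    (P : Finset ι) (deg : ι → ℕ) (c : ι → F) (D : ι → Prop) [DecidablePred D] {a : F} (ha : a ≠ 0)
    {n q : ℕ} (hq : 0 < q) (ℓ : ℕ)
    (hP : ∀ d b, 1 ≤ d → ∑ p ∈ P with deg p = d ∧ c p = b, deg p ≤ 2 * q ^ (d - 1)) :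
    (n : ℝ) * (P.powerset.filter fun S ↦
        ∑ p ∈ S, deg p = n ∧ ∏ p ∈ S, c p = a ∧ (S.filter D).card = ℓ).card ≤
      2 * (q : ℝ) ^ (n - 1) * ∑ T ∈ P.powerset with
        ((T.filter D).card = ℓ ∨ (T.filter D).card + 1 = ℓ), ∏ p ∈ T, ((q : ℝ) ^ deg p)⁻¹ := by
  set 𝓕 := P.powerset.filter fun S ↦
    ∑ p ∈ S, deg p = n ∧ ∏ p ∈ S, c p = a ∧ (S.filter D).card = ℓ with h𝓕
  set 𝓖 := P.powerset.filter fun T ↦ (T.filter D).card = ℓ ∨ (T.filter D).card + 1 = ℓ with h𝓖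
  have hcard : ∀ p ∈ P, (𝓕.filter (p ∈ ·)).card ≤
      (𝓖.filter fun T ↦ deg p + ∑ r ∈ T, deg r = n ∧ c p * ∏ r ∈ T, c r = a).card := by
    intro p _
    refine Finset.card_le_card_of_injOn (·.erase p) ?_ ?_
    · intro S hS
      simp only [h𝓕, h𝓖, Finset.coe_filter, Finset.mem_filter, Finset.mem_powerset,
        Set.mem_ofPred_eq] at hS ⊢
      obtain ⟨⟨hSP, hdeg, hc, hD⟩, hp⟩ := hS
      refine ⟨⟨(Finset.erase_subset _ _).trans hSP, ?_⟩, ?_, ?_⟩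
      · rw [Finset.filter_erase]
        by_cases hDp : D p
        · right
          rw [Finset.card_erase_add_one (by simp [hp, hDp]), hD]
        · left
          rw [Finset.erase_eq_of_notMem (by simp [hDp]), hD]
      · rw [Finset.add_sum_erase _ _ hp, hdeg]
      · rw [Finset.mul_prod_erase _ _ hp, hc]
    · intro S hS T hT h
      simp only [Finset.coe_filter, Set.mem_ofPred_eq] at hS hT
      rw [← Finset.insert_erase hS.2, ← Finset.insert_erase hT.2]
      exact congrArg (insert p) h
  have hcount : n * 𝓕.card ≤ ∑ T ∈ 𝓖, ∑ p ∈ P with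
      (deg p + ∑ r ∈ T, deg r = n ∧ c p * ∏ r ∈ T, c r = a), deg p := by
    calc n * 𝓕.card = ∑ S ∈ 𝓕, ∑ p ∈ P, if p ∈ S then deg p else 0 := by
          rw [mul_comm, ← smul_eq_mul, ← Finset.sum_const]
          refine Finset.sum_congr rfl fun S hS ↦ ?_
          simp only [h𝓕, Finset.mem_filter, Finset.mem_powerset] at hS
          rw [← hS.2.1, ← Finset.sum_filter, Finset.filter_mem_eq_inter,
            Finset.inter_eq_right.2 hS.1]
      _ = ∑ p ∈ P, (𝓕.filter (p ∈ ·)).card * deg p := by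
          rw [Finset.sum_comm]
          refine Finset.sum_congr rfl fun p _ ↦ ?_
          rw [← Finset.sum_filter, Finset.sum_const, smul_eq_mul]
      _ ≤ ∑ p ∈ P, (𝓖.filter fun T ↦
            deg p + ∑ r ∈ T, deg r = n ∧ c p * ∏ r ∈ T, c r = a).card * deg p :=
          Finset.sum_le_sum fun p hp ↦ Nat.mul_le_mul_right _ (hcard p hp)
      _ = ∑ p ∈ P, ∑ T ∈ 𝓖, if (deg p + ∑ r ∈ T, deg r = n ∧ c p * ∏ r ∈ T, c r = a)
            then deg p else 0 := by
          refine Finset.sum_congr rfl fun p _ ↦ ?_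
          rw [← Finset.sum_filter, Finset.sum_const, smul_eq_mul]
      _ = _ := by
          rw [Finset.sum_comm]
          exact Finset.sum_congr rfl fun T _ ↦ (Finset.sum_filter _ _).symm
  have hcountR := Nat.cast_le (α := ℝ).2 hcount
  rw [Nat.cast_mul] at hcountR
  refine hcountR.trans ?_
  rw [Finset.mul_sum, Nat.cast_sum]
  refine Finset.sum_le_sum fun T _ ↦ ?_
  have hq0 : (0 : ℝ) < q := by exact_mod_cast hq
  rw [Finset.prod_inv_distrib, Finset.prod_pow_eq_pow_sum]
  rcases lt_or_ge (∑ r ∈ T, deg r) n with hlt | hge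
  · have hle : ∑ p ∈ P with (deg p + ∑ r ∈ T, deg r = n ∧ c p * ∏ r ∈ T, c r = a), deg p ≤
        2 * q ^ (n - ∑ r ∈ T, deg r - 1) := by
      refine le_trans (Finset.sum_le_sum_of_subset fun p hp ↦ ?_)
        (hP (n - ∑ r ∈ T, deg r) (a / ∏ r ∈ T, c r) (by lia))
      simp only [Finset.mem_filter] at hp ⊢
      obtain ⟨hpP, hdeg, hc⟩ := hp
      have hne : ∏ r ∈ T, c r ≠ 0 := fun h ↦ ha (by rw [← hc, h, mul_zero])
      exact ⟨hpP, by lia, by rw [eq_div_iff hne, hc]⟩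
    refine (Nat.cast_le (α := ℝ).2 hle).trans_eq ?_
    push_cast
    rw [mul_assoc, show n - 1 = n - ∑ r ∈ T, deg r - 1 + ∑ r ∈ T, deg r by lia, pow_add,
      mul_assoc, mul_inv_cancel₀ (by positivity), mul_one]
  · rw [Finset.sum_eq_zero]
    · simp only [Nat.cast_zero]; positivity
    · intro p hp
      have := (Finset.mem_filter.1 hp).2.1
      lia

theorem finite_setOf_natDegree_le (F : Type*) [Field F] [Finite F] (n : ℕ) :
    {p : F[X] | p.natDegree ≤ n}.Finite := by
  have : Finite (degreeLT F (n + 1)) :=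
    Finite.of_equiv _ (degreeLTEquiv F (n + 1)).symm.toEquiv
  refine (Set.toFinite (degreeLT F (n + 1) : Set F[X])).subset fun p hp ↦ ?_
  rw [SetLike.mem_coe, mem_degreeLT]
  exact degree_le_natDegree.trans_lt (by exact_mod_cast Nat.lt_succ_of_le hp)

/-- Sum of reciprocal norms of monic irreducible polynomials with degrees in a given finite set. -/
theorem sum_inv_pow_natDegree_le {F : Type*} [Field F] [Fintype F] (s : Finset F[X])
    (hs : ∀ p ∈ s, p.Monic ∧ Irreducible p) (I : Finset ℕ) (hI : ∀ p ∈ s, p.natDegree ∈ I) :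
    ∑ p ∈ s, ((Fintype.card F : ℝ) ^ p.natDegree)⁻¹ ≤ ∑ d ∈ I, (1 : ℝ) / d := by
  have hq : (0 : ℝ) < Fintype.card F := by exact_mod_cast Fintype.card_pos
  rw [← Finset.sum_fiberwise_of_maps_to hI]
  refine Finset.sum_le_sum fun d _ ↦ ?_
  rw [Finset.sum_congr rfl fun p hp ↦ by rw [(Finset.mem_filter.1 hp).2], Finset.sum_const,
    nsmul_eq_mul]
  rcases Nat.eq_zero_or_pos d with rfl | hd
  · have : s.filter (·.natDegree = 0) = ∅ := Finset.filter_eq_empty_iff.2 fun p hp h ↦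
      (hs p hp).2.natDegree_pos.ne' h
    simp [this]
  · have h : (d : ℝ) * (s.filter (·.natDegree = d)).card ≤ (Fintype.card F : ℝ) ^ d := by
      exact_mod_cast degree_mul_card_irreducible_le hd (s.filter (·.natDegree = d)) fun p hp ↦
        ⟨(hs p (Finset.mem_filter.1 hp).1).1, (hs p (Finset.mem_filter.1 hp).1).2,
          (Finset.mem_filter.1 hp).2⟩
    have hd0 : (0 : ℝ) < d := by exact_mod_cast hd
    rw [← div_eq_mul_inv, div_le_div_iff₀ (by positivity) hd0]
    linarith

open UniqueFactorizationMonoid in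
theorem mem_primeFactors_iff_monic {F : Type*} [Field F] [DecidableEq F] {f p : F[X]}
    (hf : f ≠ 0) :
    p ∈ primeFactors f ↔ p.Monic ∧ Irreducible p ∧ p ∣ f := by
  rw [mem_primeFactors, mem_normalizedFactors_iff' hf]
  refine ⟨fun ⟨h1, h2, h3⟩ ↦ ⟨?_, h1, h3⟩, fun ⟨h1, h2, h3⟩ ↦ ⟨h2, h1.normalize_eq_self, h3⟩⟩
  exact h2 ▸ monic_normalize h1.ne_zero

open UniqueFactorizationMonoid in
theorem prod_primeFactors_of_monic_squarefree {F : Type*} [Field F] [DecidableEq F] {f : F[X]}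
    (hf : f.Monic) (hsq : Squarefree f) : ∏ p ∈ primeFactors f, p = f := by
  have hassoc : Associated (∏ p ∈ primeFactors f, p) f := by
    rw [Finset.prod_eq_multiset_prod, Multiset.map_id',
      primeFactors_val_eq_normalizedFactors hsq.isRadical]
    exact prod_normalizedFactors hf.ne_zero
  exact eq_of_monic_of_associated
    (monic_prod_of_monic _ _ fun p hp ↦ ((mem_primeFactors_iff_monic hf.ne_zero).1 hp).1)
    hf hassoc

open UniqueFactorizationMonoid in
/-- Squarefree monic polynomials correspond to sets of monic irreducible polynomials. -/
theorem ncard_squarefree_le {F : Type*} [Field F] [DecidableEq F] (P : Finset F[X])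
    (n k ℓ : ℕ) (a : F) (hP : ∀ p : F[X], p.Monic → Irreducible p → p.natDegree ≤ n → p ∈ P) :
    {f : F[X] | f.Monic ∧ Squarefree f ∧ f.natDegree = n ∧ f.coeff 0 = a ∧
        {g : F[X] | g.Monic ∧ Irreducible g ∧ g.natDegree ≤ k ∧ g ∣ f}.ncard = ℓ}.ncard ≤
      (P.powerset.filter fun S ↦ ∑ p ∈ S, p.natDegree = n ∧ ∏ p ∈ S, p.coeff 0 = a ∧
        (S.filter (·.natDegree ≤ k)).card = ℓ).card := by
  rw [← Set.ncard_coe_finset]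
  refine Set.ncard_le_ncard_of_injOn primeFactors ?_ ?_ (Finset.finite_toSet _)
  · rintro f ⟨hf, hsq, hdeg, hc, hℓ⟩
    have hmem : ∀ p, p ∈ primeFactors f ↔ p.Monic ∧ Irreducible p ∧ p ∣ f :=
      fun p ↦ mem_primeFactors_iff_monic hf.ne_zero
    have hprod := prod_primeFactors_of_monic_squarefree hf hsq
    rw [Finset.mem_coe, Finset.mem_filter, Finset.mem_powerset]
    refine ⟨fun p hp ↦ ?_, ?_, ?_, ?_⟩
    · obtain ⟨h1, h2, h3⟩ := (hmem p).1 hp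
      exact hP p h1 h2 (hdeg ▸ natDegree_le_of_dvd h3 hf.ne_zero)
    · rw [← natDegree_prod _ _ fun p hp ↦ ((hmem p).1 hp).1.ne_zero, hprod, hdeg]
    · rw [← coeff_zero_prod, hprod, hc]
    · rw [← hℓ, ← Set.ncard_coe_finset]
      congr 1
      ext p
      simp only [Finset.coe_filter, hmem, Set.mem_ofPred_eq]
      tauto
  · rintro f ⟨hf, hsq, -⟩ g ⟨hg, hgsq, -⟩ h
    rw [← prod_primeFactors_of_monic_squarefree hf hsq, h,
      prod_primeFactors_of_monic_squarefree hg hgsq]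

/-- **Poisson-type corollary, unrestricted case.**
The number of squarefree monic polynomials `f` of degree `n` over a finite field with `q`
elements, with constant coefficient `a ≠ 0`, having exactly `ℓ` distinct monic irreducible
factors of degree `≤ k` (where `1 ≤ k ≤ n`), is
`≤ C (qⁿ⁻¹/k) (H_k^ℓ/ℓ!) (1 + ℓ/H_k)`. -/
theorem stmt6 : ∃ C : ℝ, 0 < C ∧
    ∀ (F : Type) [Field F] [Fintype F], ∀ (q n k ℓ : ℕ) (a : F),
      Fintype.card F = q → 1 ≤ k → k ≤ n → a ≠ 0 →
      ({f : F[X] | f.Monic ∧ Squarefree f ∧ f.natDegree = n ∧ f.coeff 0 = a ∧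
          {g : F[X] | g.Monic ∧ Irreducible g ∧ g.natDegree ≤ k ∧ g ∣ f}.ncard = ℓ}.ncard : ℝ) ≤
        C * ((q : ℝ) ^ (n - 1) / (k : ℝ)) * ((harm k) ^ ℓ / (Nat.factorial ℓ : ℝ)) *
          (1 + (ℓ : ℝ) / harm k) := by
  classical
  refine ⟨2, two_pos, fun F _ _ q n k ℓ a hcard hk hkn ha ↦ ?_⟩
  subst hcard
  set q := Fintype.card F with hq
  have hq0 : 0 < q := Fintype.card_pos
  have hn0 : (0 : ℝ) < n := by exact_mod_cast hk.trans hkn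
  have hk0 : (0 : ℝ) < k := by exact_mod_cast hk
  have hharm : 0 < harm k :=
    Finset.sum_pos (fun d hd ↦ by have := (Finset.mem_Icc.1 hd).1; positivity) ⟨1, by simp [hk]⟩
  have hfin : {p : F[X] | p.Monic ∧ Irreducible p ∧ p.natDegree ≤ n}.Finite :=
    (finite_setOf_natDegree_le F n).subset fun p hp ↦ hp.2.2
  let P := hfin.toFinset
  have hP : ∀ p, p ∈ P ↔ p.Monic ∧ Irreducible p ∧ p.natDegree ≤ n := fun p ↦ by simp [P]
  let w : F[X] → ℝ := fun p ↦ ((q : ℝ) ^ p.natDegree)⁻¹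
  have hw : ∀ p, 0 ≤ w p := fun p ↦ by positivity
  have hmain := mul_card_le_sum_powerset P natDegree (coeff · 0) (natDegree · ≤ k) ha
    (n := n) hq0 ℓ fun d b hd ↦ by
      rw [Finset.sum_congr rfl fun p hp ↦ (Finset.mem_filter.1 hp).2.1, Finset.sum_const,
        smul_eq_mul, mul_comm]
      refine degree_mul_card_irreducible_coeff_zero_le hd b _ fun p hp ↦ ?_
      obtain ⟨hpP, hp⟩ := Finset.mem_filter.1 hp
      exact ⟨((hP p).1 hpP).1, ((hP p).1 hpP).2.1, hp⟩
  have hsmall : ∑ p ∈ P with p.natDegree ≤ k, w p ≤ harm k :=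
    sum_inv_pow_natDegree_le _ (fun p hp ↦ by
      have := (hP p).1 (Finset.mem_filter.1 hp).1
      exact ⟨this.1, this.2.1⟩) _ fun p hp ↦ by
        obtain ⟨hpP, hp⟩ := Finset.mem_filter.1 hp
        exact Finset.mem_Icc.2 ⟨((hP p).1 hpP).2.1.natDegree_pos, hp⟩
  have hlarge : ∏ p ∈ P with ¬ p.natDegree ≤ k, (1 + w p) ≤ n / k := by
    refine (Real.prod_one_add_le_exp_sum _ fun p ↦ hw p).trans
      ((Real.exp_le_exp.2 ?_).trans (exp_sum_inv_le hk hkn))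
    refine sum_inv_pow_natDegree_le _ (fun p hp ↦ ?_) _ fun p hp ↦ ?_
    · have := (hP p).1 (Finset.mem_filter.1 hp).1
      exact ⟨this.1, this.2.1⟩
    · obtain ⟨hpP, hp⟩ := Finset.mem_filter.1 hp
      exact Finset.mem_Ioc.2 ⟨not_le.1 hp, ((hP p).1 hpP).2.2⟩
  have hj : ∀ j : ℕ, ∑ T ∈ P.powerset,
      (if (T.filter (natDegree · ≤ k)).card = j then ∏ p ∈ T, w p else 0) ≤
      harm k ^ j / j.factorial * (n / k) := fun j ↦ by
    refine (sum_powerset_prod_le P (natDegree · ≤ k) hw j).trans ?_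
    have : 0 ≤ ∑ p ∈ P with p.natDegree ≤ k, w p := Finset.sum_nonneg fun p _ ↦ hw p
    gcongr
  have hsum : ∑ T ∈ P.powerset with ((T.filter (natDegree · ≤ k)).card = ℓ ∨
      (T.filter (natDegree · ≤ k)).card + 1 = ℓ), ∏ p ∈ T, w p ≤
      harm k ^ ℓ / ℓ.factorial * (1 + ℓ / harm k) * (n / k) := by
    rcases ℓ with _ | m
    · have := hj 0
      rw [← Finset.sum_filter] at this
      simpa using this
    · have hsplit : harm k ^ (m + 1) / (m + 1).factorial * (1 + (m + 1 : ℕ) / harm k) * (n / k) =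
          harm k ^ (m + 1) / (m + 1).factorial * (n / k) + harm k ^ m / m.factorial * (n / k) := by
        rw [Nat.factorial_succ]
        push_cast
        field_simp
        ring
      rw [hsplit]
      refine le_trans ?_ (add_le_add (hj (m + 1)) (hj m))
      rw [Finset.sum_filter, ← Finset.sum_add_distrib]
      refine Finset.sum_le_sum fun T _ ↦ ?_
      have : 0 ≤ ∏ p ∈ T, w p := Finset.prod_nonneg fun p _ ↦ hw p
      split_ifs <;> first | linarith | lia
  have hcount := ncard_squarefree_le P n k ℓ a fun p h1 h2 h3 ↦ (hP p).2 ⟨h1, h2, h3⟩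
  refine (Nat.cast_le (α := ℝ).2 hcount).trans (le_of_mul_le_mul_left (hmain.trans ?_) hn0)
  refine (mul_le_mul_of_nonneg_left hsum (by positivity)).trans_eq ?_
  field_simp
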